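/- Let X be a topological space whose Borel σ-algebra carries a measure μ, let Y ⊆ X with μ(cl Y) < ∞, and let Y be written as a disjoint union Y = A ⊔ B. If there exists a set Z ⊆ cl A that is open in the subspace cl Y, has measure μ(Z) = μ(cl Y) > 0, and is disjoint from Y \ A, then A is generic in Y (i.e. μ(cl A) > 0 and μ(cl B) = 0). -/

import Mathlib

open MeasureTheory

/-- Lemma 4.3(1), direction "⇐": if `μ (cl Y) < ∞` and there exists a set `Z ⊆ cl A`,
open in the subspace `cl Y`, of full (positive) measure `μ Z = μ (cl Y) > 0`, and disjoint
from `Y \ A`, then `A` is generic in `Y = A ⊔ B`. -/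
theorem exists_open_full_measure_implies_generic
    {X : Type*} [TopologicalSpace X] [MeasurableSpace X] [BorelSpace X]
    (μ : Measure X) (Y A B : Set X)
    (hY : Y = A ∪ B) (hAB : Disjoint A B)
    (hfin : μ (closure Y) < ⊤)
    (hZ : ∃ Z : Set X, Z ⊆ closure A ∧
      (∃ U : Set X, IsOpen U ∧ Z = U ∩ closure Y) ∧
      μ Z = μ (closure Y) ∧ 0 < μ (closure Y) ∧
      Disjoint Z (Y \ A)) :
    0 < μ (closure A) ∧ μ (closure B) = 0 := by
  obtain ⟨Z, hZA, ⟨U, hU, rfl⟩, hμZ, hpos, hdisj⟩ := hZ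
  refine ⟨(hμZ ▸ hpos).trans_le (measure_mono hZA), ?_⟩
  have hBY : B ⊆ Y := hY ▸ Set.subset_union_right
  have hUB : Disjoint U B := Set.disjoint_left.2 fun x hxU hxB =>
    Set.disjoint_left.1 hdisj ⟨hxU, subset_closure (hBY hxB)⟩
      ⟨hBY hxB, fun hxA => Set.disjoint_left.1 hAB hxA hxB⟩
  have hsub : closure B ⊆ closure Y \ (U ∩ closure Y) := fun x hx =>
    ⟨closure_mono hBY hx, fun hxZ => Set.disjoint_left.1 (hUB.closure_right hU) hxZ.1 hx⟩
  refine measure_mono_null hsub ?_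
  rw [measure_sdiff Set.inter_subset_right
    (hU.measurableSet.inter isClosed_closure.measurableSet).nullMeasurableSet
    (hμZ ▸ hfin.ne), hμZ, tsub_self]
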